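/- A Boolean function in character form f : 𝔽₂ⁿ → {−1, 1} satisfies the strict avalanche criterion if and only if for every index i ∈ {1, …, n} one has ∑_{w ∈ 𝔽₂ⁿ, wᵢ = 0} f̂(w)² = 1/2 and ∑_{w ∈ 𝔽₂ⁿ, wᵢ = 1} f̂(w)² = 1/2. -/

import Mathlib

open Finset

/-- The Fourier coefficient of `f : 𝔽₂ⁿ → ℝ` at `u ∈ 𝔽₂ⁿ`:
`f̂(u) = 2^{−n} ∑_{x ∈ 𝔽₂ⁿ} f(x)(−1)^{u·x}`, where `u·x` is the inner product over `𝔽₂`. -/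
noncomputable def walshCoeff {n : ℕ} (f : (Fin n → ZMod 2) → ℝ) (u : Fin n → ZMod 2) : ℝ :=
  ((2 : ℝ) ^ n)⁻¹ * ∑ x : Fin n → ZMod 2, f x * (-1 : ℝ) ^ (∑ i, u i * x i).val

/-- The Hamming weight of `a ∈ 𝔽₂ⁿ`: the number of nonzero coordinates. -/
def hammingWt {n : ℕ} (a : Fin n → ZMod 2) : ℕ :=
  (univ.filter fun i => a i = 1).card

/-- `f : 𝔽₂ⁿ → {−1, 1}` satisfies the strict avalanche criterion (SAC) if for every
`a ∈ 𝔽₂ⁿ` with Hamming weight `1`, the derivative `x ↦ f(x)f(x+a)` is balanced, i.e.,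
takes each of the values `1` and `−1` on exactly `2^{n−1}` inputs. -/
def satisfiesSAC {n : ℕ} (f : (Fin n → ZMod 2) → ℝ) : Prop :=
  ∀ a : Fin n → ZMod 2, hammingWt a = 1 →
    (univ.filter fun x => f x * f (x + a) = 1).card = 2 ^ (n - 1) ∧
    (univ.filter fun x => f x * f (x + a) = -1).card = 2 ^ (n - 1)

lemma neg_one_pow_val_add (a b : ZMod 2) :
    (-1 : ℝ) ^ (a + b).val = (-1) ^ a.val * (-1) ^ b.val := by
  rw [ZMod.val_add, ← pow_add, ← neg_one_pow_eq_pow_mod_two]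

lemma neg_one_pow_val_dotProduct_add {n : ℕ} (u x y : Fin n → ZMod 2) :
    (-1 : ℝ) ^ (u ⬝ᵥ (x + y)).val = (-1) ^ (u ⬝ᵥ x).val * (-1) ^ (u ⬝ᵥ y).val := by
  rw [dotProduct_add, neg_one_pow_val_add]

lemma add_self_eq_zero_of_zmod_two {n : ℕ} (x : Fin n → ZMod 2) : x + x = 0 :=
  funext fun i => CharTwo.add_self_eq_zero (x i)

/-- Orthogonality of the characters of `𝔽₂ⁿ`. -/
lemma sum_neg_one_pow_val_dotProduct {n : ℕ} (x : Fin n → ZMod 2) :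
    ∑ w : Fin n → ZMod 2, (-1 : ℝ) ^ (w ⬝ᵥ x).val = if x = 0 then 2 ^ n else 0 := by
  split_ifs with h
  · simp [h, ZMod.card]
  · obtain ⟨j, hj⟩ := Function.ne_iff.mp h
    have hj1 : x j = 1 := by
      have hz : ∀ z : ZMod 2, z ≠ 0 → z = 1 := by decide
      exact hz _ hj
    have key : ∑ w : Fin n → ZMod 2, (-1 : ℝ) ^ (w ⬝ᵥ x).val =
        -∑ w : Fin n → ZMod 2, (-1 : ℝ) ^ (w ⬝ᵥ x).val := by
      rw [← sum_neg_distrib]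
      refine (Fintype.sum_equiv (Equiv.addRight (Pi.single j 1)) _ _ fun w => ?_).symm
      rw [Equiv.coe_addRight, add_dotProduct, neg_one_pow_val_add, single_dotProduct, hj1]
      simp [ZMod.val_one]
    linarith

/-- The Wiener–Khinchin identity: the autocorrelation is the transform of the squared
Fourier coefficients. -/
lemma sum_walshCoeff_sq_mul {n : ℕ} (f : (Fin n → ZMod 2) → ℝ) (a : Fin n → ZMod 2) :
    ∑ w, walshCoeff f w ^ 2 * (-1 : ℝ) ^ (w ⬝ᵥ a).val =
      ((2 : ℝ) ^ n)⁻¹ * ∑ x, f x * f (x + a) := by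
  have expand (w : Fin n → ZMod 2) : walshCoeff f w ^ 2 * (-1 : ℝ) ^ (w ⬝ᵥ a).val =
      (((2 : ℝ) ^ n)⁻¹) ^ 2 *
        ∑ x, ∑ y, f x * f y * (-1 : ℝ) ^ (w ⬝ᵥ (x + a + y)).val := by
    change (((2 : ℝ) ^ n)⁻¹ * ∑ x, f x * (-1 : ℝ) ^ (w ⬝ᵥ x).val) ^ 2 * _ = _
    rw [mul_pow, mul_assoc, sq (∑ x, _), sum_mul_sum, sum_mul]
    congr 1
    refine sum_congr rfl fun x _ => ?_
    rw [sum_mul]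
    refine sum_congr rfl fun y _ => ?_
    rw [neg_one_pow_val_dotProduct_add, neg_one_pow_val_dotProduct_add]
    ring
  have inner (x : Fin n → ZMod 2) :
      ∑ w, ∑ y, f x * f y * (-1 : ℝ) ^ (w ⬝ᵥ (x + a + y)).val =
        2 ^ n * (f x * f (x + a)) := by
    rw [sum_comm]
    simp_rw [← mul_sum, sum_neg_one_pow_val_dotProduct]
    rw [sum_eq_single (x + a)]
    · rw [if_pos (add_self_eq_zero_of_zmod_two _)]
      ring
    · intro y _ hy
      rw [if_neg, mul_zero]
      intro h
      exact hy (add_left_cancel (h.trans (add_self_eq_zero_of_zmod_two (x + a)).symm))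
    · simp
  simp_rw [expand]
  rw [← mul_sum, sum_comm]
  simp_rw [inner]
  rw [← mul_sum]
  field_simp

lemma sum_eq_sum_filter_add_sum_filter {n : ℕ} (g : (Fin n → ZMod 2) → ℝ) (i : Fin n) :
    ∑ w, g w = ∑ w ∈ univ.filter (fun w : Fin n → ZMod 2 => w i = 0), g w +
      ∑ w ∈ univ.filter (fun w : Fin n → ZMod 2 => w i = 1), g w := by
  rw [← sum_filter_add_sum_filter_not univ (fun w : Fin n → ZMod 2 => w i = 0)]
  congr 2
  ext w
  simp only [mem_filter, mem_univ, true_and]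
  generalize w i = z
  revert z
  decide

/-- Parseval's identity for a function with values in `{−1, 1}`. -/
lemma sum_filter_walshCoeff_sq_add {n : ℕ} (f : (Fin n → ZMod 2) → ℝ)
    (hf : ∀ x, f x = 1 ∨ f x = -1) (i : Fin n) :
    ∑ w ∈ univ.filter (fun w : Fin n → ZMod 2 => w i = 0), walshCoeff f w ^ 2 +
      ∑ w ∈ univ.filter (fun w : Fin n → ZMod 2 => w i = 1), walshCoeff f w ^ 2 = 1 := by
  have h := sum_walshCoeff_sq_mul f 0
  have hsq (x) : f x * f x = 1 := by rcases hf x with h | h <;> simp [h]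
  rw [← sum_eq_sum_filter_add_sum_filter]
  simpa [hsq, ZMod.card] using h

lemma sum_filter_walshCoeff_sq_sub {n : ℕ} (f : (Fin n → ZMod 2) → ℝ) (i : Fin n) :
    ∑ w ∈ univ.filter (fun w : Fin n → ZMod 2 => w i = 0), walshCoeff f w ^ 2 -
      ∑ w ∈ univ.filter (fun w : Fin n → ZMod 2 => w i = 1), walshCoeff f w ^ 2 =
      ((2 : ℝ) ^ n)⁻¹ * ∑ x, f x * f (x + Pi.single i 1) := by
  rw [← sum_walshCoeff_sq_mul, sum_eq_sum_filter_add_sum_filter _ i, sub_eq_add_neg,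
    ← sum_neg_distrib]
  congr 1 <;> refine sum_congr rfl fun w hw => ?_
  · simp [dotProduct_single, (mem_filter.mp hw).2]
  · simp [dotProduct_single, (mem_filter.mp hw).2, ZMod.val_one]

/-- A `{−1, 1}`-valued function on `𝔽₂ⁿ`, `n ≥ 1`, is balanced iff its sum vanishes. -/
lemma balanced_iff_sum_eq_zero {n : ℕ} (hn : n ≠ 0) (g : (Fin n → ZMod 2) → ℝ)
    (hg : ∀ x, g x = 1 ∨ g x = -1) :
    ((univ.filter fun x => g x = 1).card = 2 ^ (n - 1) ∧
      (univ.filter fun x => g x = -1).card = 2 ^ (n - 1)) ↔ ∑ x, g x = 0 := by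
  have hneg : (univ.filter fun x => ¬ g x = 1) = univ.filter fun x => g x = -1 := by
    ext x
    rcases hg x with h | h <;> simp [h] <;> norm_num
  have hcard := card_filter_add_card_filter_not (s := univ) (fun x => g x = 1)
  have hsum := sum_filter_add_sum_filter_not univ (fun x => g x = 1) g
  rw [hneg] at hcard hsum
  rw [sum_congr rfl fun x hx => (mem_filter.mp hx).2,
    sum_congr (s₁ := univ.filter fun x => g x = -1) rfl fun x hx => (mem_filter.mp hx).2] at hsum
  have hpow : 2 ^ n = 2 * 2 ^ (n - 1) := by
    rw [← pow_succ', Nat.sub_add_cancel (Nat.one_le_iff_ne_zero.mpr hn)]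
  simp only [card_univ, Fintype.card_pi, ZMod.card, prod_const, Fintype.card_fin, hpow] at hcard
  simp only [sum_const, nsmul_eq_mul, mul_one, mul_neg] at hsum
  rw [← hsum, ← sub_eq_add_neg, sub_eq_zero, Nat.cast_inj]
  omega

lemma hammingWt_eq_one_iff {n : ℕ} (a : Fin n → ZMod 2) :
    hammingWt a = 1 ↔ ∃ i, a = Pi.single i 1 := by
  rw [hammingWt, card_eq_one]
  refine exists_congr fun i => ⟨fun h => funext fun j => ?_, ?_⟩
  · have hj : a j = 1 ↔ j = i := by simpa using Finset.ext_iff.mp h j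
    by_cases hji : j = i
    · simpa [hji] using hj.mpr hji
    · have hz : ∀ z : ZMod 2, z ≠ 1 → z = 0 := by decide
      simpa [hji] using hz _ (mt hj.mp hji)
  · rintro rfl
    ext j
    simp [Pi.single_apply]

/-- A Boolean function in character form `f : 𝔽₂ⁿ → {−1, 1}` satisfies the strict avalanche
criterion if and only if for every index `i ∈ {1, …, n}` one has
`∑_{w ∈ 𝔽₂ⁿ, wᵢ = 0} f̂(w)² = 1/2` and `∑_{w ∈ 𝔽₂ⁿ, wᵢ = 1} f̂(w)² = 1/2`. -/
theorem sac_iff_half_half {n : ℕ} (f : (Fin n → ZMod 2) → ℝ)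
    (hf : ∀ x, f x = 1 ∨ f x = -1) :
    satisfiesSAC f ↔
      ∀ i : Fin n,
        (∑ w ∈ univ.filter (fun w : Fin n → ZMod 2 => w i = 0),
          (walshCoeff f w) ^ 2) = 1 / 2 ∧
        (∑ w ∈ univ.filter (fun w : Fin n → ZMod 2 => w i = 1),
          (walshCoeff f w) ^ 2) = 1 / 2 := by
  have hprod (a x : Fin n → ZMod 2) : f x * f (x + a) = 1 ∨ f x * f (x + a) = -1 := by
    rcases hf x with h | h <;> rcases hf (x + a) with h' | h' <;> simp [h, h']
  have hsac : satisfiesSAC f ↔ ∀ i : Fin n, ∑ x, f x * f (x + Pi.single i 1) = 0 := by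
    simp only [satisfiesSAC, hammingWt_eq_one_iff, forall_exists_index, forall_eq_apply_imp_iff]
    exact forall_congr' fun i => balanced_iff_sum_eq_zero i.pos.ne' _ (hprod _)
  rw [hsac]
  refine forall_congr' fun i => ?_
  have hadd := sum_filter_walshCoeff_sq_add f hf i
  have hsub := sum_filter_walshCoeff_sq_sub f i
  constructor
  · intro h
    rw [h, mul_zero] at hsub
    constructor <;> linarith
  · rintro ⟨h0, h1⟩
    rw [h0, h1, sub_self] at hsub
    exact (mul_eq_zero.mp hsub.symm).resolve_left (by positivity)
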